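/- Composed simulations under confluence: (i) let S be a confluent fragment of the call-by-value calculus; for every closed term M ∈ S and value V, if M (=ℓ∪β^S)* V then there exists a value V' with V (=ℓ^S)* V' and (M~) λx.x →a∪β* Ψ(V'); (ii) let T be a confluent fragment of the call-by-name calculus; for every closed term M ∈ T and value V, if M (=a∪β^T)* V then there exists a value V' with V (=a^T)* V' and (⟦M⟧) λx.x →ℓ∪β* Φ(V'). (Here R* denotes the reflexive-transitive closure of a relation R.) -/

import Mathlib

namespace AlgLam

/-- Terms of the algebraic λ-calculus over a ring of scalars `R`,
    in de Bruijn representation. -/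
inductive Term (R : Type u) : Type u
  | var : ℕ → Term R
  | lam : Term R → Term R
  | app : Term R → Term R → Term R
  | zero : Term R
  | smul : R → Term R → Term R
  | add : Term R → Term R → Term R

namespace Term

variable {R : Type u}

/-- De Bruijn lifting: shift the free indices `≥ d` up by one. -/
def lift (d : ℕ) : Term R → Term R
  | var n => if n < d then var n else var (n + 1)
  | lam M => lam (lift (d + 1) M)
  | app M N => app (lift d M) (lift d N)
  | zero => zero
  | smul a M => smul a (lift d M)
  | add M N => add (lift d M) (lift d N)

/-- Capture-avoiding substitution of `N` for the free de Bruijn index `d`. -/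
def subst (d : ℕ) (N : Term R) : Term R → Term R
  | var n => if n < d then var n else if n = d then N else var (n - 1)
  | lam M => lam (subst (d + 1) (lift 0 N) M)
  | app M L => app (subst d N M) (subst d N L)
  | zero => zero
  | smul a M => smul a (subst d N M)
  | add M L => add (subst d N M) (subst d N L)

/-- Base terms: variables and λ-abstractions. -/
inductive IsBase : Term R → Prop
  | var (n : ℕ) : IsBase (var n)
  | lam (M : Term R) : IsBase (lam M)

/-- Values: `0`, base terms, scalar multiples of values, sums of values. -/
inductive IsValue : Term R → Prop
  | zero : IsValue zero
  | base {B : Term R} : IsBase B → IsValue B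
  | smul (a : R) {V : Term R} : IsValue V → IsValue (smul a V)
  | add {V W : Term R} : IsValue V → IsValue W → IsValue (add V W)

/-- `ClosedUnder d M` : every free index of `M` is `< d`. -/
def ClosedUnder : ℕ → Term R → Prop
  | d, var n => n < d
  | d, lam M => ClosedUnder (d + 1) M
  | d, app M N => ClosedUnder d M ∧ ClosedUnder d N
  | _, zero => True
  | d, smul _ M => ClosedUnder d M
  | d, add M N => ClosedUnder d M ∧ ClosedUnder d N

/-- A closed term (a program). -/
def Closed (M : Term R) : Prop := ClosedUnder 0 M

section Rules

variable [CommRing R]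

/-- The rewrite relation `→a` of the call-by-name algebraic λ-calculus:
    ring rules and call-by-name application rules, closed under the ξ contexts. -/
inductive StepA : Term R → Term R → Prop
  -- ring rules
  | assocL (M N L : Term R) : StepA (add M (add N L)) (add (add M N) L)
  | assocR (M N L : Term R) : StepA (add (add M N) L) (add M (add N L))
  | comm (M N : Term R) : StepA (add M N) (add N M)
  | factor (a b : R) (M : Term R) : StepA (add (smul a M) (smul b M)) (smul (a + b) M)
  | factor1 (a : R) (M : Term R) : StepA (add (smul a M) M) (smul (a + 1) M)
  | factor11 (M : Term R) : StepA (add M M) (smul (1 + 1) M)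
  | mulMul (a b : R) (M : Term R) : StepA (smul a (smul b M)) (smul (a * b) M)
  | mulDist (a : R) (M N : Term R) : StepA (smul a (add M N)) (add (smul a M) (smul a N))
  | oneSmul (M : Term R) : StepA (smul 1 M) M
  | zeroSmul (M : Term R) : StepA (smul 0 M) zero
  | smulZero (a : R) : StepA (smul a zero) zero
  | zeroAdd (M : Term R) : StepA (add zero M) M
  -- call-by-name application rules (A)
  | appAdd (M N L : Term R) : StepA (app (add M N) L) (add (app M L) (app N L))
  | appSmul (a : R) (M N : Term R) : StepA (app (smul a M) N) (smul a (app M N))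
  | appZero (M : Term R) : StepA (app zero M) zero
  -- ξ context rules
  | ctxAppL {M M' : Term R} (N : Term R) : StepA M M' → StepA (app M N) (app M' N)
  | ctxAddL {M M' : Term R} (N : Term R) : StepA M M' → StepA (add M N) (add M' N)
  | ctxAddR {N N' : Term R} (M : Term R) : StepA N N' → StepA (add M N) (add M N')
  | ctxSmul (a : R) {M M' : Term R} : StepA M M' → StepA (smul a M) (smul a M')

/-- The call-by-name β-reduction `→βn`, closed under the ξ contexts. -/
inductive StepBn : Term R → Term R → Prop
  | beta (M N : Term R) : StepBn (app (lam M) N) (subst 0 N M)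
  | ctxAppL {M M' : Term R} (N : Term R) : StepBn M M' → StepBn (app M N) (app M' N)
  | ctxAddL {M M' : Term R} (N : Term R) : StepBn M M' → StepBn (add M N) (add M' N)
  | ctxAddR {N N' : Term R} (M : Term R) : StepBn N N' → StepBn (add M N) (add M N')
  | ctxSmul (a : R) {M M' : Term R} : StepBn M M' → StepBn (smul a M) (smul a M')

/-- The rewrite relation `→a∪β`. -/
def StepAB (M N : Term R) : Prop := StepA M N ∨ StepBn M N

/-- The rewrite relation `→ℓ` of the call-by-value algebraic λ-calculus:
    ring rules, left- and right-linearity rules, closed under ξ and ξ_lin. -/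
inductive StepL : Term R → Term R → Prop
  -- ring rules
  | assocL (M N L : Term R) : StepL (add M (add N L)) (add (add M N) L)
  | assocR (M N L : Term R) : StepL (add (add M N) L) (add M (add N L))
  | comm (M N : Term R) : StepL (add M N) (add N M)
  | factor (a b : R) (M : Term R) : StepL (add (smul a M) (smul b M)) (smul (a + b) M)
  | factor1 (a : R) (M : Term R) : StepL (add (smul a M) M) (smul (a + 1) M)
  | factor11 (M : Term R) : StepL (add M M) (smul (1 + 1) M)
  | mulMul (a b : R) (M : Term R) : StepL (smul a (smul b M)) (smul (a * b) M)
  | mulDist (a : R) (M N : Term R) : StepL (smul a (add M N)) (add (smul a M) (smul a N))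
  | oneSmul (M : Term R) : StepL (smul 1 M) M
  | zeroSmul (M : Term R) : StepL (smul 0 M) zero
  | smulZero (a : R) : StepL (smul a zero) zero
  | zeroAdd (M : Term R) : StepL (add zero M) M
  -- left linearity (A_l), the argument must be a value
  | appAddV {V : Term R} (M N : Term R) : IsValue V →
      StepL (app (add M N) V) (add (app M V) (app N V))
  | appSmulV {V : Term R} (a : R) (M : Term R) : IsValue V →
      StepL (app (smul a M) V) (smul a (app M V))
  | appZeroV {V : Term R} : IsValue V → StepL (app zero V) zero
  -- right linearity (A_r), the function must be a base term
  | appAddB {B : Term R} (M N : Term R) : IsBase B →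
      StepL (app B (add M N)) (add (app B M) (app B N))
  | appSmulB {B : Term R} (a : R) (M : Term R) : IsBase B →
      StepL (app B (smul a M)) (smul a (app B M))
  | appZeroB {B : Term R} : IsBase B → StepL (app B zero) zero
  -- ξ context rules
  | ctxAppL {M M' : Term R} (N : Term R) : StepL M M' → StepL (app M N) (app M' N)
  | ctxAddL {M M' : Term R} (N : Term R) : StepL M M' → StepL (add M N) (add M' N)
  | ctxAddR {N N' : Term R} (M : Term R) : StepL N N' → StepL (add M N) (add M N')
  | ctxSmul (a : R) {M M' : Term R} : StepL M M' → StepL (smul a M) (smul a M')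
  -- ξ_lin context rule
  | ctxAppR {V M M' : Term R} : IsValue V → StepL M M' → StepL (app V M) (app V M')

/-- The call-by-value β-reduction `→βv`, closed under ξ and ξ_lin. -/
inductive StepBv : Term R → Term R → Prop
  | beta (M : Term R) {B : Term R} : IsBase B → StepBv (app (lam M) B) (subst 0 B M)
  | ctxAppL {M M' : Term R} (N : Term R) : StepBv M M' → StepBv (app M N) (app M' N)
  | ctxAddL {M M' : Term R} (N : Term R) : StepBv M M' → StepBv (add M N) (add M' N)
  | ctxAddR {N N' : Term R} (M : Term R) : StepBv N N' → StepBv (add M N) (add M N')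
  | ctxSmul (a : R) {M M' : Term R} : StepBv M M' → StepBv (smul a M) (smul a M')
  | ctxAppR {V M M' : Term R} : IsValue V → StepBv M M' → StepBv (app V M) (app V M')

/-- The rewrite relation `→ℓ∪β`. -/
def StepLB (M N : Term R) : Prop := StepL M N ∨ StepBv M N

end Rules

/-- Steps of `→a` performed by an associativity or commutativity rule
    (closed under the ξ contexts). -/
inductive StepACa : Term R → Term R → Prop
  | assocL (M N L : Term R) : StepACa (add M (add N L)) (add (add M N) L)
  | assocR (M N L : Term R) : StepACa (add (add M N) L) (add M (add N L))
  | comm (M N : Term R) : StepACa (add M N) (add N M)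
  | ctxAppL {M M' : Term R} (N : Term R) : StepACa M M' → StepACa (app M N) (app M' N)
  | ctxAddL {M M' : Term R} (N : Term R) : StepACa M M' → StepACa (add M N) (add M' N)
  | ctxAddR {N N' : Term R} (M : Term R) : StepACa N N' → StepACa (add M N) (add M N')
  | ctxSmul (a : R) {M M' : Term R} : StepACa M M' → StepACa (smul a M) (smul a M')

/-- Steps of `→ℓ` performed by an associativity or commutativity rule
    (closed under the ξ and ξ_lin contexts). -/
inductive StepACl : Term R → Term R → Prop
  | assocL (M N L : Term R) : StepACl (add M (add N L)) (add (add M N) L)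
  | assocR (M N L : Term R) : StepACl (add (add M N) L) (add M (add N L))
  | comm (M N : Term R) : StepACl (add M N) (add N M)
  | ctxAppL {M M' : Term R} (N : Term R) : StepACl M M' → StepACl (app M N) (app M' N)
  | ctxAddL {M M' : Term R} (N : Term R) : StepACl M M' → StepACl (add M N) (add M' N)
  | ctxAddR {N N' : Term R} (M : Term R) : StepACl N N' → StepACl (add M N) (add M N')
  | ctxSmul (a : R) {M M' : Term R} : StepACl M M' → StepACl (smul a M) (smul a M')
  | ctxAppR {V M M' : Term R} : IsValue V → StepACl M M' → StepACl (app V M) (app V M')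

section NonAC

variable [CommRing R]

/-- Steps of `→a` performed by a rule other than associativity or commutativity of `+`
    (closed under the ξ contexts). -/
inductive StepNAa : Term R → Term R → Prop
  | factor (a b : R) (M : Term R) : StepNAa (add (smul a M) (smul b M)) (smul (a + b) M)
  | factor1 (a : R) (M : Term R) : StepNAa (add (smul a M) M) (smul (a + 1) M)
  | factor11 (M : Term R) : StepNAa (add M M) (smul (1 + 1) M)
  | mulMul (a b : R) (M : Term R) : StepNAa (smul a (smul b M)) (smul (a * b) M)
  | mulDist (a : R) (M N : Term R) : StepNAa (smul a (add M N)) (add (smul a M) (smul a N))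
  | oneSmul (M : Term R) : StepNAa (smul 1 M) M
  | zeroSmul (M : Term R) : StepNAa (smul 0 M) zero
  | smulZero (a : R) : StepNAa (smul a zero) zero
  | zeroAdd (M : Term R) : StepNAa (add zero M) M
  | appAdd (M N L : Term R) : StepNAa (app (add M N) L) (add (app M L) (app N L))
  | appSmul (a : R) (M N : Term R) : StepNAa (app (smul a M) N) (smul a (app M N))
  | appZero (M : Term R) : StepNAa (app zero M) zero
  | ctxAppL {M M' : Term R} (N : Term R) : StepNAa M M' → StepNAa (app M N) (app M' N)
  | ctxAddL {M M' : Term R} (N : Term R) : StepNAa M M' → StepNAa (add M N) (add M' N)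
  | ctxAddR {N N' : Term R} (M : Term R) : StepNAa N N' → StepNAa (add M N) (add M N')
  | ctxSmul (a : R) {M M' : Term R} : StepNAa M M' → StepNAa (smul a M) (smul a M')

/-- Steps of `→ℓ` performed by a rule other than associativity or commutativity of `+`
    (closed under the ξ and ξ_lin contexts). -/
inductive StepNAl : Term R → Term R → Prop
  | factor (a b : R) (M : Term R) : StepNAl (add (smul a M) (smul b M)) (smul (a + b) M)
  | factor1 (a : R) (M : Term R) : StepNAl (add (smul a M) M) (smul (a + 1) M)
  | factor11 (M : Term R) : StepNAl (add M M) (smul (1 + 1) M)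
  | mulMul (a b : R) (M : Term R) : StepNAl (smul a (smul b M)) (smul (a * b) M)
  | mulDist (a : R) (M N : Term R) : StepNAl (smul a (add M N)) (add (smul a M) (smul a N))
  | oneSmul (M : Term R) : StepNAl (smul 1 M) M
  | zeroSmul (M : Term R) : StepNAl (smul 0 M) zero
  | smulZero (a : R) : StepNAl (smul a zero) zero
  | zeroAdd (M : Term R) : StepNAl (add zero M) M
  | appAddV {V : Term R} (M N : Term R) : IsValue V →
      StepNAl (app (add M N) V) (add (app M V) (app N V))
  | appSmulV {V : Term R} (a : R) (M : Term R) : IsValue V →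
      StepNAl (app (smul a M) V) (smul a (app M V))
  | appZeroV {V : Term R} : IsValue V → StepNAl (app zero V) zero
  | appAddB {B : Term R} (M N : Term R) : IsBase B →
      StepNAl (app B (add M N)) (add (app B M) (app B N))
  | appSmulB {B : Term R} (a : R) (M : Term R) : IsBase B →
      StepNAl (app B (smul a M)) (smul a (app B M))
  | appZeroB {B : Term R} : IsBase B → StepNAl (app B zero) zero
  | ctxAppL {M M' : Term R} (N : Term R) : StepNAl M M' → StepNAl (app M N) (app M' N)
  | ctxAddL {M M' : Term R} (N : Term R) : StepNAl M M' → StepNAl (add M N) (add M' N)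
  | ctxAddR {N N' : Term R} (M : Term R) : StepNAl N N' → StepNAl (add M N) (add M N')
  | ctxSmul (a : R) {M M' : Term R} : StepNAl M M' → StepNAl (smul a M) (smul a M')
  | ctxAppR {V M M' : Term R} : IsValue V → StepNAl M M' → StepNAl (app V M) (app V M')

end NonAC

/-- The call-by-value-to-call-by-name encoding `M ↦ M~`.
    The fresh variables `f`, `g`, `h` are handled by de Bruijn lifting. -/
def cbvEnc : Term R → Term R
  | var n => lam (app (var 0) (var (n + 1)))
  | zero => zero
  | lam M => lam (app (var 0) (lift 0 (lam (cbvEnc M))))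
  | app M N =>
      lam (app (lift 0 (cbvEnc M))
        (lam (app (lift 0 (lift 0 (cbvEnc N)))
          (lam (app (app (var 1) (var 0)) (var 2))))))
  | smul a M => lam (app (smul a (lift 0 (cbvEnc M))) (var 0))
  | add M N => lam (app (add (lift 0 (cbvEnc M)) (lift 0 (cbvEnc N))) (var 0))

/-- The value encoding `Ψ` (its value on non-values is irrelevant). -/
def psi : Term R → Term R
  | var n => var n
  | zero => zero
  | lam M => lam (cbvEnc M)
  | smul a V => smul a (psi V)
  | add V W => add (psi V) (psi W)
  | app M N => app (psi M) (psi N)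

/-- The call-by-name-to-call-by-value encoding `M ↦ ⟦M⟧`. -/
def cbnEnc : Term R → Term R
  | var n => var n
  | zero => lam (app zero (var 0))
  | lam M => lam (app (var 0) (lift 0 (lam (cbnEnc M))))
  | app M N =>
      lam (app (lift 0 (cbnEnc M))
        (lam (app (app (var 0) (lift 0 (lift 0 (cbnEnc N)))) (var 1))))
  | smul a M => lam (app (smul a (lift 0 (cbnEnc M))) (var 0))
  | add M N => lam (app (add (lift 0 (cbnEnc M)) (lift 0 (cbnEnc N))) (var 0))

/-- The value encoding `Φ` (its value on non-values is irrelevant). -/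
def phi : Term R → Term R
  | var n => app (var n) (lam (var 0))
  | zero => zero
  | lam M => lam (cbnEnc M)
  | smul a V => smul a (phi V)
  | add V W => add (phi V) (phi W)
  | app M N => app (phi M) (phi N)

/-- A measure on terms used to define the administrative operation `(:)`. -/
def size : Term R → ℕ
  | var _ => 1
  | lam _ => 1
  | zero => 1
  | smul _ M => 1 + size M
  | add M N => 1 + size M + size N
  | app M N => size M * (size N + 1)

theorem size_pos : ∀ M : Term R, 0 < size M
  | var _ => Nat.one_pos
  | lam _ => Nat.one_pos
  | zero => Nat.one_pos
  | smul _ M => by simp [size]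
  | add M N => by simp [size]
  | app M N => Nat.mul_pos (size_pos M) (Nat.succ_pos _)

/-- The administrative infix operation `(:)` of the call-by-value to call-by-name
    simulation: `colon M K` is `M : K`. -/
def colon : Term R → Term R → Term R
  | zero, _ => zero
  | var n, K => app K (var n)
  | lam M, K => app K (lam (cbvEnc M))
  | smul a M, K => smul a (colon M K)
  | add M N, K => add (colon M K) (colon N K)
  | app zero _, _ => zero
  | app (var n) N, K =>
      colon N (lam (app (app (var (n + 1)) (var 0)) (lift 0 K)))
  | app (lam M) N, K =>
      colon N (lam (app (app (lift 0 (lam (cbvEnc M))) (var 0)) (lift 0 K)))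
  | app (smul a M) N, K => smul a (colon (app M N) K)
  | app (add M M') N, K => add (colon (app M N) K) (colon (app M' N) K)
  | app (app M M') L, K =>
      colon (app M M')
        (lam (app (lift 0 (cbvEnc L))
          (lam (app (app (var 1) (var 0)) (lift 0 (lift 0 K))))))
termination_by M _ => size M
decreasing_by
  all_goals simp only [size]
  · omega
  · omega
  · omega
  · nlinarith [size_pos N]
  · nlinarith [size_pos N]
  · nlinarith [size_pos M, size_pos N]
  · nlinarith [size_pos M, size_pos M', size_pos N]
  · nlinarith [size_pos M, size_pos M', size_pos N]
  · nlinarith [size_pos L, Nat.mul_pos (size_pos M) (Nat.succ_pos (size M'))]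



section Equalities

variable [CommRing R]

/-- The restricted algebraic equality `=ℓ^F` on a fragment `F`. -/
def EqL (F : Set (Term R)) (M N : Term R) : Prop :=
  M ∈ F ∧ N ∈ F ∧ (StepL M N ∨ StepL N M)

/-- The relation `=ℓ∪β^F` : restricted algebraic equality together with `→βv` restricted to `F`. -/
def EqLB (F : Set (Term R)) (M N : Term R) : Prop :=
  EqL F M N ∨ (M ∈ F ∧ N ∈ F ∧ StepBv M N)

/-- The restricted algebraic equality `=a^F` on a fragment `F`. -/
def EqA (F : Set (Term R)) (M N : Term R) : Prop :=
  M ∈ F ∧ N ∈ F ∧ (StepA M N ∨ StepA N M)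

/-- The relation `=a∪β^F` : restricted algebraic equality together with `→βn` restricted to `F`. -/
def EqAB (F : Set (Term R)) (M N : Term R) : Prop :=
  EqA F M N ∨ (M ∈ F ∧ N ∈ F ∧ StepBn M N)

/-- The unrestricted algebraic equality `=ℓ` (symmetric closure of `→ℓ`). -/
def EqLfull (M N : Term R) : Prop := StepL M N ∨ StepL N M

/-- The unrestricted relation `=ℓ∪β`. -/
def EqLBfull (M N : Term R) : Prop := EqLfull M N ∨ StepBv M N

/-- The unrestricted algebraic equality `=a` (symmetric closure of `→a`). -/
def EqAfull (M N : Term R) : Prop := StepA M N ∨ StepA N M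

/-- The unrestricted relation `=a∪β`. -/
def EqABfull (M N : Term R) : Prop := EqAfull M N ∨ StepBn M N

end Equalities

section Substitution

theorem subst_lift (M : Term R) : ∀ (d : ℕ) (N : Term R), subst d N (lift d M) = M := by
  induction M with
  | var n =>
    intro d N
    by_cases h : n < d
    · simp [lift, subst, h]
    · have h₁ : ¬ n + 1 < d := by omega
      have h₂ : n + 1 ≠ d := by omega
      simp [lift, subst, h, h₁, h₂]
  | lam M ih => intro d N; simp [lift, subst, ih]
  | app M N ihM ihN => intro d L; simp [lift, subst, ihM, ihN]
  | zero => intro d N; rfl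
  | smul a M ih => intro d N; simp [lift, subst, ih]
  | add M N ihM ihN => intro d L; simp [lift, subst, ihM, ihN]

theorem lift_lift (M : Term R) :
    ∀ {i j : ℕ}, i ≤ j → lift (j + 1) (lift i M) = lift i (lift j M) := by
  induction M with
  | var n =>
    intro i j h
    simp only [lift]
    split_ifs <;> simp only [lift] <;> split_ifs <;> first | rfl | omega
  | lam M ih => intro i j h; simp [lift, ih (Nat.succ_le_succ h)]
  | app M N ihM ihN => intro i j h; simp [lift, ihM h, ihN h]
  | zero => intro i j h; rfl
  | smul a M ih => intro i j h; simp [lift, ih h]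
  | add M N ihM ihN => intro i j h; simp [lift, ihM h, ihN h]

theorem subst_succ_lift (M : Term R) :
    ∀ {i d : ℕ} (N : Term R), i ≤ d →
      subst (d + 1) (lift i N) (lift i M) = lift i (subst d N M) := by
  induction M with
  | var n =>
    intro i d N h
    simp only [lift, subst]
    split_ifs <;> simp only [lift, subst] <;> split_ifs <;>
      first | rfl | omega | (congr 1; omega)
  | lam M ih =>
    intro i d N h
    simp only [lift, subst]
    rw [← ih _ (Nat.succ_le_succ h), lift_lift N (Nat.zero_le i)]
  | app M L ihM ihL => intro i d N h; simp [lift, subst, ihM N h, ihL N h]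
  | zero => intro i d N h; rfl
  | smul a M ih => intro i d N h; simp [lift, subst, ih N h]
  | add M L ihM ihL => intro i d N h; simp [lift, subst, ihM N h, ihL N h]

theorem cbvEnc_lift (M : Term R) : ∀ d : ℕ, cbvEnc (lift d M) = lift d (cbvEnc M) := by
  induction M with
  | var n =>
    intro d
    by_cases h : n < d <;> simp [lift, cbvEnc, h]
  | lam M ih =>
    intro d
    simp [lift, cbvEnc, ih, lift_lift (cbvEnc M) (Nat.succ_le_succ (Nat.zero_le d))]
  | app M N ihM ihN =>
    intro d
    simp [lift, cbvEnc, ihM, ihN, lift_lift _ (Nat.zero_le _)]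
  | zero => intro d; rfl
  | smul a M ih => intro d; simp [lift, cbvEnc, ih, lift_lift _ (Nat.zero_le d)]
  | add M N ihM ihN => intro d; simp [lift, cbvEnc, ihM, ihN, lift_lift _ (Nat.zero_le d)]

theorem cbnEnc_lift (M : Term R) : ∀ d : ℕ, cbnEnc (lift d M) = lift d (cbnEnc M) := by
  induction M with
  | var n =>
    intro d
    by_cases h : n < d <;> simp [lift, cbnEnc, h]
  | lam M ih =>
    intro d
    simp [lift, cbnEnc, ih, lift_lift (cbnEnc M) (Nat.succ_le_succ (Nat.zero_le d))]
  | app M N ihM ihN =>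
    intro d
    simp [lift, cbnEnc, ihM, ihN, lift_lift _ (Nat.zero_le _)]
  | zero => intro d; simp [lift, cbnEnc]
  | smul a M ih => intro d; simp [lift, cbnEnc, ih, lift_lift _ (Nat.zero_le d)]
  | add M N ihM ihN => intro d; simp [lift, cbnEnc, ihM, ihN, lift_lift _ (Nat.zero_le d)]

theorem isBase_lift {B : Term R} (hB : IsBase B) (d : ℕ) : IsBase (lift d B) := by
  cases hB with
  | var n => simp only [lift]; split_ifs <;> exact .var _
  | lam M => exact .lam _

theorem psi_lift_of_isBase {B : Term R} (hB : IsBase B) (d : ℕ) :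
    psi (lift d B) = lift d (psi B) := by
  cases hB with
  | var n => by_cases h : n < d <;> simp [lift, psi, h]
  | lam M => simp [lift, psi, cbvEnc_lift]

theorem cbvEnc_of_isBase {B : Term R} (hB : IsBase B) :
    cbvEnc B = lam (app (var 0) (lift 0 (psi B))) := by
  cases hB <;> simp [cbvEnc, psi, lift]

theorem cbvEnc_subst (M : Term R) :
    ∀ (d : ℕ) {B : Term R}, IsBase B →
      cbvEnc (subst d B M) = subst d (psi B) (cbvEnc M) := by
  induction M with
  | var n =>
    intro d B hB
    rcases lt_trichotomy n d with h | h | h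
    · simp [subst, cbvEnc, h]
    · subst h; simp [subst, cbvEnc, cbvEnc_of_isBase hB]
    · have h₁ : ¬ n < d := by omega
      have h₂ : n ≠ d := by omega
      have h₃ : n - 1 + 1 = n := by omega
      simp [subst, cbvEnc, h₁, h₂, h₃]
  | lam M ih =>
    intro d B hB
    have h := subst_succ_lift (lam (cbvEnc M)) (psi B) (Nat.zero_le d)
    simp only [subst, cbvEnc, ih _ (isBase_lift hB 0), psi_lift_of_isBase hB] at h ⊢
    simp [h]
  | app M N ihM ihN =>
    intro d B hB
    simp [subst, cbvEnc, ihM d hB, ihN d hB, subst_succ_lift _ _ (Nat.zero_le _)]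
  | zero => intro d B hB; rfl
  | smul a M ih =>
    intro d B hB
    simp [subst, cbvEnc, ih d hB, subst_succ_lift _ _ (Nat.zero_le _)]
  | add M N ihM ihN =>
    intro d B hB
    simp [subst, cbvEnc, ihM d hB, ihN d hB, subst_succ_lift _ _ (Nat.zero_le _)]

theorem cbnEnc_subst (M : Term R) :
    ∀ (d : ℕ) (N : Term R), cbnEnc (subst d N M) = subst d (cbnEnc N) (cbnEnc M) := by
  induction M with
  | var n =>
    intro d N
    simp only [subst, cbnEnc]
    split_ifs <;> rfl
  | lam M ih =>
    intro d N
    have h := subst_succ_lift (lam (cbnEnc M)) (cbnEnc N) (Nat.zero_le d)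
    simp only [subst, cbnEnc, ih, cbnEnc_lift] at h ⊢
    simp [h]
  | app M L ihM ihL =>
    intro d N
    simp [subst, cbnEnc, ihM, ihL, subst_succ_lift _ _ (Nat.zero_le _)]
  | zero => intro d N; simp [subst, cbnEnc]
  | smul a M ih =>
    intro d N
    simp [subst, cbnEnc, ih, subst_succ_lift _ _ (Nat.zero_le _)]
  | add M L ihM ihL =>
    intro d N
    simp [subst, cbnEnc, ihM, ihL, subst_succ_lift _ _ (Nat.zero_le _)]

theorem isBase_cbnEnc (M : Term R) : IsBase (cbnEnc M) := by
  cases M <;> constructor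

end Substitution

section Continuations

/-- The continuation `λh.((B) h) K` waiting for the argument of a base function. -/
def cbvArgCont (B K : Term R) : Term R :=
  lam (app (app (lift 0 B) (var 0)) (lift 0 K))

/-- The continuation `λg.(N~) λh.((g) h) K` waiting for a function. -/
def cbvFunCont (N K : Term R) : Term R :=
  lam (app (lift 0 (cbvEnc N)) (lam (app (app (var 1) (var 0)) (lift 0 (lift 0 K)))))

theorem colon_base {B : Term R} (hB : IsBase B) (K : Term R) : colon B K = app K (psi B) := by
  cases hB <;> simp [colon, psi]

theorem colon_app_base {B : Term R} (hB : IsBase B) (N K : Term R) :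
    colon (app B N) K = colon N (cbvArgCont (psi B) K) := by
  cases hB <;> simp [colon, psi, cbvArgCont, lift]

theorem colon_app_app (M M' L K : Term R) :
    colon (app (app M M') L) K = colon (app M M') (cbvFunCont L K) := by
  rw [colon]; rfl

theorem beta_cbvFunCont (N K B : Term R) :
    StepBn (app (cbvFunCont N K) B) (app (cbvEnc N) (cbvArgCont B K)) := by
  have h := StepBn.beta
    (app (lift 0 (cbvEnc N)) (lam (app (app (var 1) (var 0)) (lift 0 (lift 0 K))))) B
  have h' := subst_succ_lift (lift 0 K) B (Nat.zero_le 0)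
  simp only [subst_lift] at h'
  simpa [subst, subst_lift, h', cbvFunCont, cbvArgCont] using h

theorem beta_cbvArgCont (F K B : Term R) :
    StepBn (app (cbvArgCont F K) B) (app (app F B) K) := by
  have h := StepBn.beta (app (app (lift 0 F) (var 0)) (lift 0 K)) B
  simpa [subst, subst_lift, cbvArgCont] using h

/-- The continuation `λg.((g) ⟦N⟧) K` waiting for a function. -/
def cbnFunCont (N K : Term R) : Term R :=
  lam (app (app (var 0) (lift 0 (cbnEnc N))) (lift 0 K))

/-- The administrative operation of the call-by-name to call-by-value simulation:
`cbnColon M none K` is `M : K`, and `cbnColon M (some L) K` is `(M) L : K`. -/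
def cbnColon : Term R → Option (Term R) → Term R → Term R
  | var n, none, K => app (var n) K
  | var n, some L, K => app (var n) (cbnFunCont L K)
  | lam M, none, K => app K (lam (cbnEnc M))
  | lam M, some L, K => app (app (lam (cbnEnc M)) (cbnEnc L)) K
  | app M N, none, K => cbnColon M (some N) K
  | app M N, some L, K => cbnColon M (some N) (cbnFunCont L K)
  | zero, _, _ => zero
  | smul a M, o, K => smul a (cbnColon M o K)
  | add M N, o, K => add (cbnColon M o K) (cbnColon N o K)

theorem beta_cbnFunCont (N K : Term R) {B : Term R} (hB : IsBase B) :
    StepBv (app (cbnFunCont N K) B) (app (app B (cbnEnc N)) K) := by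
  have h := StepBv.beta (app (app (var 0) (lift 0 (cbnEnc N))) (lift 0 K)) hB
  simpa [subst, subst_lift, cbnFunCont] using h

end Continuations

theorem StepBv.not_isValue {V W : Term R} (h : StepBv V W) : ¬ IsValue V := by
  intro hV
  induction h with
  | ctxAddL N _ ih =>
    rcases hV with _ | ⟨⟨⟩⟩ | _ | ⟨h₁, _⟩
    exact ih h₁
  | ctxAddR M _ ih =>
    rcases hV with _ | ⟨⟨⟩⟩ | _ | ⟨_, h₂⟩
    exact ih h₂
  | ctxSmul a _ ih =>
    rcases hV with _ | ⟨⟨⟩⟩ | ⟨_, h⟩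
    exact ih h
  | _ => rcases hV with _ | ⟨⟨⟩⟩

theorem StepBn.not_isValue {V W : Term R} (h : StepBn V W) : ¬ IsValue V := by
  intro hV
  induction h with
  | ctxAddL N _ ih =>
    rcases hV with _ | ⟨⟨⟩⟩ | _ | ⟨h₁, _⟩
    exact ih h₁
  | ctxAddR M _ ih =>
    rcases hV with _ | ⟨⟨⟩⟩ | _ | ⟨_, h₂⟩
    exact ih h₂
  | ctxSmul a _ ih =>
    rcases hV with _ | ⟨⟨⟩⟩ | ⟨_, h⟩
    exact ih h
  | _ => rcases hV with _ | ⟨⟨⟩⟩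

section Simulation

open Relation

variable [CommRing R]

theorem StepA.rtc {M N : Term R} (h : StepA M N) : ReflTransGen StepAB M N := .single (.inl h)

theorem StepBn.rtc {M N : Term R} (h : StepBn M N) : ReflTransGen StepAB M N := .single (.inr h)

theorem StepL.rtc {M N : Term R} (h : StepL M N) : ReflTransGen StepLB M N := .single (.inl h)

theorem StepBv.rtc {M N : Term R} (h : StepBv M N) : ReflTransGen StepLB M N := .single (.inr h)

theorem rtc_stepAB_smul (a : R) {M M' : Term R} (h : ReflTransGen StepAB M M') :
    ReflTransGen StepAB (smul a M) (smul a M') :=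
  h.lift (smul a) fun _ _ => Or.imp (.ctxSmul a) (.ctxSmul a)

theorem rtc_stepAB_add {M M' N N' : Term R} (hM : ReflTransGen StepAB M M')
    (hN : ReflTransGen StepAB N N') : ReflTransGen StepAB (add M N) (add M' N') :=
  (hM.lift (fun X => add X N) fun _ _ => Or.imp (.ctxAddL N) (.ctxAddL N)).trans
    (hN.lift (add M') fun _ _ => Or.imp (.ctxAddR M') (.ctxAddR M'))

theorem rtc_stepLB_smul (a : R) {M M' : Term R} (h : ReflTransGen StepLB M M') :
    ReflTransGen StepLB (smul a M) (smul a M') :=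
  h.lift (smul a) fun _ _ => Or.imp (.ctxSmul a) (.ctxSmul a)

theorem rtc_stepLB_add {M M' N N' : Term R} (hM : ReflTransGen StepLB M M')
    (hN : ReflTransGen StepLB N N') : ReflTransGen StepLB (add M N) (add M' N') :=
  (hM.lift (fun X => add X N) fun _ _ => Or.imp (.ctxAddL N) (.ctxAddL N)).trans
    (hN.lift (add M') fun _ _ => Or.imp (.ctxAddR M') (.ctxAddR M'))

theorem rtc_colon_cbvFunCont {L : Term R}
    (hL : ∀ K, ReflTransGen StepAB (app (cbvEnc L) K) (colon L K)) (M K : Term R) :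
    ReflTransGen StepAB (colon M (cbvFunCont L K)) (colon (app M L) K) := by
  have base : ∀ {B : Term R}, IsBase B →
      ReflTransGen StepAB (colon B (cbvFunCont L K)) (colon (app B L) K) := by
    intro B hB
    rw [colon_base hB, colon_app_base hB]
    exact (beta_cbvFunCont L K _).rtc.trans (hL _)
  induction M with
  | var n => exact base (.var n)
  | lam M => exact base (.lam M)
  | app M N => rw [colon_app_app]
  | zero => simp only [colon]; exact .refl
  | smul a M ih => simp only [colon]; exact rtc_stepAB_smul a ih
  | add M N ihM ihN => simp only [colon]; exact rtc_stepAB_add ihM ihN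

theorem rtc_app_cbvEnc (M : Term R) :
    ∀ K, ReflTransGen StepAB (app (cbvEnc M) K) (colon M K) := by
  have base : ∀ {B : Term R}, IsBase B → ∀ K,
      ReflTransGen StepAB (app (cbvEnc B) K) (colon B K) := by
    intro B hB K
    rw [colon_base hB, cbvEnc_of_isBase hB]
    have h := StepBn.beta (app (var 0) (lift 0 (psi B))) K
    simp only [subst, subst_lift] at h
    exact h.rtc
  induction M with
  | var n => exact base (.var n)
  | lam M => exact base (.lam M)
  | app M N ihM ihN =>
    intro K
    refine .trans (StepBn.rtc ?_) ((ihM (cbvFunCont N K)).trans (rtc_colon_cbvFunCont ihN M K))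
    have h := StepBn.beta (app (lift 0 (cbvEnc M)) (lam (app (lift 0 (lift 0 (cbvEnc N)))
          (lam (app (app (var 1) (var 0)) (var 2)))))) K
    have h' := subst_succ_lift (lift 0 (cbvEnc N)) K (Nat.zero_le 0)
    simp only [subst_lift] at h'
    simpa [subst, subst_lift, h', cbvFunCont, cbvEnc] using h
  | zero =>
    intro K
    simp only [colon]
    exact (StepA.appZero K).rtc
  | smul a M ih =>
    intro K
    simp only [colon]
    have h := StepBn.beta (app (smul a (lift 0 (cbvEnc M))) (var 0)) K
    simp only [subst, subst_lift] at h
    exact h.rtc.trans ((StepA.appSmul _ _ _).rtc.trans (rtc_stepAB_smul a (ih K)))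
  | add M N ihM ihN =>
    intro K
    simp only [colon]
    have h := StepBn.beta (app (add (lift 0 (cbvEnc M)) (lift 0 (cbvEnc N))) (var 0)) K
    simp only [subst, subst_lift] at h
    exact h.rtc.trans ((StepA.appAdd _ _ _).rtc.trans (rtc_stepAB_add (ihM K) (ihN K)))

theorem rtc_colon_id_psi {V : Term R} (hV : IsValue V) :
    ReflTransGen StepAB (colon V (lam (var 0))) (psi V) := by
  induction hV with
  | zero => simp only [colon]; exact .refl
  | base hB => rw [colon_base hB]; exact (StepBn.beta (var 0) _).rtc
  | smul a _ ih => simp only [colon]; exact rtc_stepAB_smul a ih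
  | add _ _ ihV ihW => simp only [colon]; exact rtc_stepAB_add ihV ihW

theorem rtc_colon_app_right {V M M' : Term R} (hV : IsValue V)
    (h : ∀ K, ReflTransGen StepAB (colon M K) (colon M' K)) (K : Term R) :
    ReflTransGen StepAB (colon (app V M) K) (colon (app V M') K) := by
  induction hV with
  | zero => simp only [colon]; exact .refl
  | base hB => rw [colon_app_base hB, colon_app_base hB]; exact h _
  | smul a _ ih => simp only [colon]; exact rtc_stepAB_smul a ih
  | add _ _ ihV ihW => simp only [colon]; exact rtc_stepAB_add ihV ihW

theorem rtc_colon_app_left {M N P : Term R}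
    (h : ∀ K, ReflTransGen StepAB (colon (app M N) K) (colon P K)) (L K : Term R) :
    ReflTransGen StepAB (colon (app (app M N) L) K) (colon (app P L) K) := by
  rw [colon_app_app]
  exact (h _).trans (rtc_colon_cbvFunCont (rtc_app_cbvEnc L) P K)

/-- Simulation of a reduction both at the top level and in function position. -/
def ColonSim (M M' : Term R) : Prop :=
  (∀ K, ReflTransGen StepAB (colon M K) (colon M' K)) ∧
    ∀ L K, ReflTransGen StepAB (colon (app M L) K) (colon (app M' L) K)

theorem ColonSim.of_app {M N M' : Term R}
    (h : ∀ K, ReflTransGen StepAB (colon (app M N) K) (colon M' K)) :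
    ColonSim (app M N) M' :=
  ⟨h, rtc_colon_app_left h⟩

theorem StepL.colonSim {M M' : Term R} (h : StepL M M') : ColonSim M M' := by
  induction h with
  | assocL M N L => constructor <;> intros <;> simp only [colon] <;> exact (StepA.assocL _ _ _).rtc
  | assocR M N L => constructor <;> intros <;> simp only [colon] <;> exact (StepA.assocR _ _ _).rtc
  | comm M N => constructor <;> intros <;> simp only [colon] <;> exact (StepA.comm _ _).rtc
  | factor a b M =>
    constructor <;> intros <;> simp only [colon] <;> exact (StepA.factor _ _ _).rtc
  | factor1 a M => constructor <;> intros <;> simp only [colon] <;> exact (StepA.factor1 _ _).rtc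
  | factor11 M => constructor <;> intros <;> simp only [colon] <;> exact (StepA.factor11 _).rtc
  | mulMul a b M =>
    constructor <;> intros <;> simp only [colon] <;> exact (StepA.mulMul _ _ _).rtc
  | mulDist a M N =>
    constructor <;> intros <;> simp only [colon] <;> exact (StepA.mulDist _ _ _).rtc
  | oneSmul M => constructor <;> intros <;> simp only [colon] <;> exact (StepA.oneSmul _).rtc
  | zeroSmul M => constructor <;> intros <;> simp only [colon] <;> exact (StepA.zeroSmul _).rtc
  | smulZero a => constructor <;> intros <;> simp only [colon] <;> exact (StepA.smulZero _).rtc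
  | zeroAdd M => constructor <;> intros <;> simp only [colon] <;> exact (StepA.zeroAdd _).rtc
  | appAddV M N hV => exact .of_app fun K => by simp only [colon]; exact .refl
  | appSmulV a M hV => exact .of_app fun K => by simp only [colon]; exact .refl
  | appZeroV hV => exact .of_app fun K => by simp only [colon]; exact .refl
  | appAddB M N hB => exact .of_app fun K => by simp only [colon, colon_app_base hB]; exact .refl
  | appSmulB a M hB => exact .of_app fun K => by simp only [colon, colon_app_base hB]; exact .refl
  | appZeroB hB => exact .of_app fun K => by simp only [colon, colon_app_base hB]; exact .refl
  | ctxAppL N _ ih => exact .of_app (ih.2 N)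
  | ctxAddL N _ ih =>
    exact ⟨fun K => by simpa only [colon] using rtc_stepAB_add (ih.1 K) .refl,
      fun L K => by simpa only [colon] using rtc_stepAB_add (ih.2 L K) .refl⟩
  | ctxAddR M _ ih =>
    exact ⟨fun K => by simpa only [colon] using rtc_stepAB_add .refl (ih.1 K),
      fun L K => by simpa only [colon] using rtc_stepAB_add .refl (ih.2 L K)⟩
  | ctxSmul a _ ih =>
    exact ⟨fun K => by simpa only [colon] using rtc_stepAB_smul a (ih.1 K),
      fun L K => by simpa only [colon] using rtc_stepAB_smul a (ih.2 L K)⟩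
  | ctxAppR hV _ ih => exact .of_app (rtc_colon_app_right hV ih.1)

theorem StepBv.colonSim {M M' : Term R} (h : StepBv M M') : ColonSim M M' := by
  induction h with
  | @beta M B hB =>
    refine .of_app fun K => ?_
    rw [colon_app_base (.lam M), colon_base hB]
    refine (beta_cbvArgCont _ _ _).rtc.trans ?_
    refine (StepBn.ctxAppL K (StepBn.beta _ _)).rtc.trans ?_
    rw [← cbvEnc_subst M 0 hB]
    exact rtc_app_cbvEnc _ K
  | ctxAppL N _ ih => exact .of_app (ih.2 N)
  | ctxAddL N _ ih =>
    exact ⟨fun K => by simpa only [colon] using rtc_stepAB_add (ih.1 K) .refl,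
      fun L K => by simpa only [colon] using rtc_stepAB_add (ih.2 L K) .refl⟩
  | ctxAddR M _ ih =>
    exact ⟨fun K => by simpa only [colon] using rtc_stepAB_add .refl (ih.1 K),
      fun L K => by simpa only [colon] using rtc_stepAB_add .refl (ih.2 L K)⟩
  | ctxSmul a _ ih =>
    exact ⟨fun K => by simpa only [colon] using rtc_stepAB_smul a (ih.1 K),
      fun L K => by simpa only [colon] using rtc_stepAB_smul a (ih.2 L K)⟩
  | ctxAppR hV _ ih => exact .of_app (rtc_colon_app_right hV ih.1)

theorem cbv_to_cbn_simulation {M V : Term R} (h : ReflTransGen StepLB M V) (hV : IsValue V) :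
    ReflTransGen StepAB (app (cbvEnc M) (lam (var 0))) (psi V) := by
  have h' : ReflTransGen StepAB (colon M (lam (var 0))) (colon V (lam (var 0))) := by
    clear hV
    induction h with
    | refl => exact .refl
    | tail _ h ih =>
      exact ih.trans (h.elim (fun h => h.colonSim.1 _) fun h => h.colonSim.1 _)
  exact (rtc_app_cbvEnc M _).trans (h'.trans (rtc_colon_id_psi hV))

theorem rtc_cbnColon_cbnFunCont (M L K : Term R) :
    ReflTransGen StepLB (cbnColon M none (cbnFunCont L K)) (cbnColon M (some L) K) := by
  induction M with
  | var n => exact .refl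
  | lam M => exact (beta_cbnFunCont L K (.lam _)).rtc
  | app M N => exact .refl
  | zero => exact .refl
  | smul a M ih => exact rtc_stepLB_smul a ih
  | add M N ihM ihN => exact rtc_stepLB_add ihM ihN

theorem rtc_app_cbnEnc (M : Term R) :
    ∀ {K : Term R}, IsBase K →
      ReflTransGen StepLB (app (cbnEnc M) K) (cbnColon M none K) := by
  induction M with
  | var n => intro K _; exact .refl
  | lam M =>
    intro K hK
    have h := StepBv.beta (app (var 0) (lift 0 (lam (cbnEnc M)))) hK
    simp only [subst, subst_lift] at h
    exact h.rtc
  | app M N ihM ihN =>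
    intro K hK
    refine .trans (StepBv.rtc ?_) ((ihM (K := cbnFunCont N K) (.lam _)).trans
      (rtc_cbnColon_cbnFunCont M N K))
    have h := StepBv.beta (app (lift 0 (cbnEnc M))
        (lam (app (app (var 0) (lift 0 (lift 0 (cbnEnc N)))) (var 1)))) hK
    have h' := subst_succ_lift (lift 0 (cbnEnc N)) K (Nat.zero_le 0)
    simp only [subst_lift] at h'
    simpa [subst, subst_lift, h', cbnFunCont, cbnEnc] using h
  | zero =>
    intro K hK
    exact (StepBv.beta (app zero (var 0)) hK).rtc.trans (StepL.appZeroV (.base hK)).rtc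
  | smul a M ih =>
    intro K hK
    have h := StepBv.beta (app (smul a (lift 0 (cbnEnc M))) (var 0)) hK
    simp only [subst, subst_lift] at h
    exact h.rtc.trans ((StepL.appSmulV _ _ (.base hK)).rtc.trans (rtc_stepLB_smul a (ih hK)))
  | add M N ihM ihN =>
    intro K hK
    have h := StepBv.beta (app (add (lift 0 (cbnEnc M)) (lift 0 (cbnEnc N))) (var 0)) hK
    simp only [subst, subst_lift] at h
    exact h.rtc.trans ((StepL.appAddV _ _ (.base hK)).rtc.trans
      (rtc_stepLB_add (ihM hK) (ihN hK)))

theorem rtc_cbnColon_id_phi {V : Term R} (hV : IsValue V) :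
    ReflTransGen StepLB (cbnColon V none (lam (var 0))) (phi V) := by
  induction hV with
  | zero => exact .refl
  | base hB =>
    cases hB with
    | var n => exact .refl
    | lam M => exact (StepBv.beta (var 0) (.lam _)).rtc
  | smul a _ ih => exact rtc_stepLB_smul a ih
  | add _ _ ihV ihW => exact rtc_stepLB_add ihV ihW

/-- Simulation of a reduction both at the top level and in function position. -/
def CbnColonSim (M M' : Term R) : Prop :=
  ∀ o {K : Term R}, IsBase K → ReflTransGen StepLB (cbnColon M o K) (cbnColon M' o K)

theorem CbnColonSim.of_app {M N M' : Term R}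
    (h : ∀ {K : Term R}, IsBase K →
      ReflTransGen StepLB (cbnColon M (some N) K) (cbnColon M' none K)) :
    CbnColonSim (app M N) M' := by
  intro o K hK
  cases o with
  | none => exact h hK
  | some L => exact (h (.lam _)).trans (rtc_cbnColon_cbnFunCont M' L K)

theorem StepA.cbnColonSim {M M' : Term R} (h : StepA M M') : CbnColonSim M M' := by
  induction h with
  | assocL M N L => exact fun _ _ _ => (StepL.assocL _ _ _).rtc
  | assocR M N L => exact fun _ _ _ => (StepL.assocR _ _ _).rtc
  | comm M N => exact fun _ _ _ => (StepL.comm _ _).rtc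
  | factor a b M => exact fun _ _ _ => (StepL.factor _ _ _).rtc
  | factor1 a M => exact fun _ _ _ => (StepL.factor1 _ _).rtc
  | factor11 M => exact fun _ _ _ => (StepL.factor11 _).rtc
  | mulMul a b M => exact fun _ _ _ => (StepL.mulMul _ _ _).rtc
  | mulDist a M N => exact fun _ _ _ => (StepL.mulDist _ _ _).rtc
  | oneSmul M => exact fun _ _ _ => (StepL.oneSmul _).rtc
  | zeroSmul M => exact fun _ _ _ => (StepL.zeroSmul _).rtc
  | smulZero a => exact fun _ _ _ => (StepL.smulZero _).rtc
  | zeroAdd M => exact fun _ _ _ => (StepL.zeroAdd _).rtc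
  | appAdd M N L => exact .of_app fun _ => .refl
  | appSmul a M N => exact .of_app fun _ => .refl
  | appZero M => exact .of_app fun _ => .refl
  | ctxAppL N _ ih => exact .of_app (ih (some N))
  | ctxAddL N _ ih => exact fun o _ hK => rtc_stepLB_add (ih o hK) .refl
  | ctxAddR M _ ih => exact fun o _ hK => rtc_stepLB_add .refl (ih o hK)
  | ctxSmul a _ ih => exact fun o _ hK => rtc_stepLB_smul a (ih o hK)

theorem StepBn.cbnColonSim {M M' : Term R} (h : StepBn M M') : CbnColonSim M M' := by
  induction h with
  | beta M N =>
    refine .of_app fun {K} hK => ?_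
    refine (StepBv.ctxAppL K (StepBv.beta _ (isBase_cbnEnc N))).rtc.trans ?_
    rw [← cbnEnc_subst]
    exact rtc_app_cbnEnc _ hK
  | ctxAppL N _ ih => exact .of_app (ih (some N))
  | ctxAddL N _ ih => exact fun o _ hK => rtc_stepLB_add (ih o hK) .refl
  | ctxAddR M _ ih => exact fun o _ hK => rtc_stepLB_add .refl (ih o hK)
  | ctxSmul a _ ih => exact fun o _ hK => rtc_stepLB_smul a (ih o hK)

theorem cbn_to_cbv_simulation {M V : Term R} (h : ReflTransGen StepAB M V) (hV : IsValue V) :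
    ReflTransGen StepLB (app (cbnEnc M) (lam (var 0))) (phi V) := by
  have h' : ReflTransGen StepLB (cbnColon M none (lam (var 0)))
      (cbnColon V none (lam (var 0))) := by
    clear hV
    induction h with
    | refl => exact .refl
    | tail _ h ih =>
      exact ih.trans (h.elim (fun h => h.cbnColonSim none (.lam _))
        fun h => h.cbnColonSim none (.lam _))
  exact (rtc_app_cbnEnc M (.lam _)).trans (h'.trans (rtc_cbnColon_id_phi hV))

end Simulation

section Values

open Relation

variable [CommRing R]

theorem StepL.isValue {V W : Term R} (h : StepL V W) (hV : IsValue V) : IsValue W := by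
  induction h with
  | assocL M N L =>
    rcases hV with _ | ⟨⟨⟩⟩ | _ | ⟨h₁, _ | ⟨⟨⟩⟩ | _ | ⟨h₂, h₃⟩⟩
    exact (h₁.add h₂).add h₃
  | assocR M N L =>
    rcases hV with _ | ⟨⟨⟩⟩ | _ | ⟨_ | ⟨⟨⟩⟩ | _ | ⟨h₁, h₂⟩, h₃⟩
    exact h₁.add (h₂.add h₃)
  | comm M N =>
    rcases hV with _ | ⟨⟨⟩⟩ | _ | ⟨h₁, h₂⟩
    exact h₂.add h₁
  | factor a b M =>
    rcases hV with _ | ⟨⟨⟩⟩ | _ | ⟨_ | ⟨⟨⟩⟩ | ⟨_, h⟩, _⟩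
    exact h.smul _
  | factor1 a M =>
    rcases hV with _ | ⟨⟨⟩⟩ | _ | ⟨_, h⟩
    exact h.smul _
  | factor11 M =>
    rcases hV with _ | ⟨⟨⟩⟩ | _ | ⟨_, h⟩
    exact h.smul _
  | mulMul a b M =>
    rcases hV with _ | ⟨⟨⟩⟩ | ⟨_, _ | ⟨⟨⟩⟩ | ⟨_, h⟩⟩
    exact h.smul _
  | mulDist a M N =>
    rcases hV with _ | ⟨⟨⟩⟩ | ⟨_, _ | ⟨⟨⟩⟩ | _ | ⟨h₁, h₂⟩⟩
    exact (h₁.smul _).add (h₂.smul _)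
  | oneSmul M =>
    rcases hV with _ | ⟨⟨⟩⟩ | ⟨_, h⟩
    exact h
  | zeroSmul M => exact .zero
  | smulZero a => exact .zero
  | zeroAdd M =>
    rcases hV with _ | ⟨⟨⟩⟩ | _ | ⟨_, h⟩
    exact h
  | ctxAddL N _ ih =>
    rcases hV with _ | ⟨⟨⟩⟩ | _ | ⟨h₁, h₂⟩
    exact (ih h₁).add h₂
  | ctxAddR M _ ih =>
    rcases hV with _ | ⟨⟨⟩⟩ | _ | ⟨h₁, h₂⟩
    exact h₁.add (ih h₂)
  | ctxSmul a _ ih =>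
    rcases hV with _ | ⟨⟨⟩⟩ | ⟨_, h⟩
    exact (ih h).smul _
  | _ => rcases hV with _ | ⟨⟨⟩⟩

theorem StepA.isValue {V W : Term R} (h : StepA V W) (hV : IsValue V) : IsValue W := by
  suffices StepL V W from this.isValue hV
  induction h with
  | ctxAddL N _ ih =>
    rcases hV with _ | ⟨⟨⟩⟩ | _ | ⟨h₁, _⟩
    exact .ctxAddL N (ih h₁)
  | ctxAddR M _ ih =>
    rcases hV with _ | ⟨⟨⟩⟩ | _ | ⟨_, h₂⟩
    exact .ctxAddR M (ih h₂)
  | ctxSmul a _ ih =>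
    rcases hV with _ | ⟨⟨⟩⟩ | ⟨_, h⟩
    exact .ctxSmul a (ih h)
  | appAdd | appSmul | appZero | ctxAppL => (rcases hV with _ | ⟨⟨⟩⟩)
  | _ => constructor

theorem rtc_eqL_of_rtc_stepLB {F : Set (Term R)} (hF : ∀ M ∈ F, ∀ N, StepLB M N → N ∈ F)
    {V W : Term R} (hV : IsValue V) (hVF : V ∈ F) (h : ReflTransGen StepLB V W) :
    IsValue W ∧ W ∈ F ∧ ReflTransGen (EqL F) V W := by
  induction h with
  | refl => exact ⟨hV, hVF, .refl⟩
  | tail _ h ih =>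
    obtain ⟨hW, hWF, ih⟩ := ih
    have hF' := hF _ hWF _ h
    rcases h with h | h
    · exact ⟨h.isValue hW, hF', ih.tail ⟨hWF, hF', .inl h⟩⟩
    · exact absurd hW h.not_isValue

theorem rtc_eqA_of_rtc_stepAB {T : Set (Term R)} (hT : ∀ M ∈ T, ∀ N, StepAB M N → N ∈ T)
    {V W : Term R} (hV : IsValue V) (hVT : V ∈ T) (h : ReflTransGen StepAB V W) :
    IsValue W ∧ W ∈ T ∧ ReflTransGen (EqA T) V W := by
  induction h with
  | refl => exact ⟨hV, hVT, .refl⟩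
  | tail _ h ih =>
    obtain ⟨hW, hWT, ih⟩ := ih
    have hT' := hT _ hWT _ h
    rcases h with h | h
    · exact ⟨h.isValue hW, hT', ih.tail ⟨hWT, hT', .inl h⟩⟩
    · exact absurd hW h.not_isValue

end Values

/-- The Church–Rosser property for a relation that is confluent on a set of terms. -/
theorem church_rosser_of_confluent_on {r s : Term R → Term R → Prop} {F : Set (Term R)}
    (hs : ∀ {M N}, s M N → M ∈ F ∧ N ∈ F ∧ (r M N ∨ r N M))
    (hF : ∀ M ∈ F, ∀ N₁ N₂, Relation.ReflTransGen r M N₁ → Relation.ReflTransGen r M N₂ →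
      ∃ L, Relation.ReflTransGen r N₁ L ∧ Relation.ReflTransGen r N₂ L)
    {M N : Term R} (hM : M ∈ F) (h : Relation.ReflTransGen s M N) :
    N ∈ F ∧ ∃ L, Relation.ReflTransGen r M L ∧ Relation.ReflTransGen r N L := by
  induction h with
  | refl => exact ⟨hM, M, .refl, .refl⟩
  | tail _ h ih =>
    obtain ⟨_, L, hML, hL⟩ := ih
    obtain ⟨hP, hQ, h | h⟩ := hs h
    · obtain ⟨L', h₁, h₂⟩ := hF _ hP _ _ hL (.single h)
      exact ⟨hQ, L', hML.trans h₁, h₂⟩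
    · exact ⟨hQ, L, hML, .head h hL⟩

section Statements

variable [CommRing R]

/-- composed simulations under confluence:
(i) for a confluent fragment `F` of the call-by-value calculus, a closed `M ∈ F`
and a value `V` with `M (=ℓ∪β^F)* V`, there is a value `V'` with `V (=ℓ^F)* V'`
and `(M~) λx.x →a∪β* Ψ(V')`;
(ii) for a confluent fragment `T` of the call-by-name calculus, a closed `M ∈ T`
and a value `V` with `M (=a∪β^T)* V`, there is a value `V'` with `V (=a^T)* V'`
and `(⟦M⟧) λx.x →ℓ∪β* Φ(V')`. -/
theorem composed_simulations_with_confluence :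
    (∀ F : Set (Term R),
      (∀ M ∈ F, ∀ N, StepLB M N → N ∈ F) →
      (∀ M ∈ F, ∀ N₁ N₂, Relation.ReflTransGen StepLB M N₁ →
        Relation.ReflTransGen StepLB M N₂ →
        ∃ L, Relation.ReflTransGen StepLB N₁ L ∧ Relation.ReflTransGen StepLB N₂ L) →
      ∀ M ∈ F, Closed M → ∀ V : Term R, IsValue V →
        Relation.ReflTransGen (EqLB F) M V →
        ∃ V', IsValue V' ∧ Relation.ReflTransGen (EqL F) V V' ∧
          Relation.ReflTransGen StepAB (app (cbvEnc M) (lam (var 0))) (psi V')) ∧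
    (∀ T : Set (Term R),
      (∀ M ∈ T, ∀ N, StepAB M N → N ∈ T) →
      (∀ M ∈ T, ∀ N₁ N₂, Relation.ReflTransGen StepAB M N₁ →
        Relation.ReflTransGen StepAB M N₂ →
        ∃ L, Relation.ReflTransGen StepAB N₁ L ∧ Relation.ReflTransGen StepAB N₂ L) →
      ∀ M ∈ T, Closed M → ∀ V : Term R, IsValue V →
        Relation.ReflTransGen (EqAB T) M V →
        ∃ V', IsValue V' ∧ Relation.ReflTransGen (EqA T) V V' ∧
          Relation.ReflTransGen StepLB (app (cbnEnc M) (lam (var 0))) (phi V')) := by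
  refine ⟨fun F hF hconf M hM _ V hV h => ?_, fun T hT hconf M hM _ V hV h => ?_⟩
  · obtain ⟨hVF, V', hMV', hVV'⟩ := church_rosser_of_confluent_on
      (by
        rintro M N (⟨hM, hN, h⟩ | ⟨hM, hN, h⟩)
        exacts [⟨hM, hN, h.imp .inl .inl⟩, ⟨hM, hN, .inl (.inr h)⟩]) hconf hM h
    obtain ⟨hV', _, hEq⟩ := rtc_eqL_of_rtc_stepLB hF hV hVF hVV'
    exact ⟨V', hV', hEq, cbv_to_cbn_simulation hMV' hV'⟩
  · obtain ⟨hVT, V', hMV', hVV'⟩ := church_rosser_of_confluent_on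
      (by
        rintro M N (⟨hM, hN, h⟩ | ⟨hM, hN, h⟩)
        exacts [⟨hM, hN, h.imp .inl .inl⟩, ⟨hM, hN, .inl (.inr h)⟩]) hconf hM h
    obtain ⟨hV', _, hEq⟩ := rtc_eqA_of_rtc_stepAB hT hV hVT hVV'
    exact ⟨V', hV', hEq, cbn_to_cbv_simulation hMV' hV'⟩

end Statements

end Term

end AlgLam
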